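/- Let n ≥ 2 and suppose (R, Δ) is a char-2 B-V datum on R such that Δ(x) = 0, Δ(w) = 0, {x,v} = v or {x,v} = v + x^{2n}·v·w, and Δ(v) = 0 or Δ(v) = x^{2n−1}·v·w. Then Δ(v) = 0. -/

import Mathlib

open MvPolynomial

noncomputable section

/-- The polynomial ring `(ℤ/2)[x,v,w]`. -/
abbrev P : Type := MvPolynomial (Fin 3) (ZMod 2)

/-- The ideal `(x^{2n+2}, v² + (n+1)·x^{2n}·w)` (the coefficient `n+1` read mod 2). -/
def relIdeal (n : ℕ) : Ideal P :=
  Ideal.span {(X 0 : P) ^ (2 * n + 2),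
    (X 1 : P) ^ 2 + C ((n : ZMod 2) + 1) * (X 0 : P) ^ (2 * n) * X 2}

/-- `R = (ℤ/2)[x,v,w]/(x^{2n+2}, v² + (n+1)x^{2n}w) ≅ ℍ_*(L ℝP^{2n+1}; ℤ/2)`. -/
abbrev R (n : ℕ) : Type := P ⧸ relIdeal n

/-- The quotient map as a `ℤ/2`-algebra homomorphism. -/
def mkR (n : ℕ) : P →ₐ[ZMod 2] R n := Ideal.Quotient.mkₐ (ZMod 2) (relIdeal n)

def x (n : ℕ) : R n := mkR n (X 0)
def v (n : ℕ) : R n := mkR n (X 1)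
def w (n : ℕ) : R n := mkR n (X 2)

lemma R_two_eq_zero (n : ℕ) : (2 : R n) = 0 := by
  have h := map_ofNat (algebraMap (ZMod 2) (R n)) 2
  rw [← h, show (OfNat.ofNat 2 : ZMod 2) = 0 from rfl, map_zero]

lemma x_pow_eq_zero (n : ℕ) : x n ^ (2 * n + 2) = 0 := by
  rw [x, ← map_pow]
  exact Ideal.Quotient.eq_zero_iff_mem.2 (Ideal.subset_span (by simp))

/-- The specialization `x ↦ X`, `v ↦ (n+1) X^n + ε`, `w ↦ 1` to dual numbers over `(ℤ/2)[X]`. -/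
def dualSpecialization (n : ℕ) : P →ₐ[ZMod 2] DualNumber (Polynomial (ZMod 2)) :=
  aeval ![TrivSqZeroExt.inl Polynomial.X,
    TrivSqZeroExt.inl (Polynomial.C ((n : ZMod 2) + 1) * Polynomial.X ^ n) + DualNumber.eps, 1]

lemma dualSpecialization_quadratic (n : ℕ) :
    dualSpecialization n
      ((X 1 : P) ^ 2 + C ((n : ZMod 2) + 1) * (X 0 : P) ^ (2 * n) * X 2) = 0 := by
  have h2 : (2 : Polynomial (ZMod 2)) = 0 := CharTwo.two_eq_zero
  have hsq : ∀ c : ZMod 2, c ^ 2 = c := by decide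
  have hC (c : ZMod 2) : algebraMap (ZMod 2) (DualNumber (Polynomial (ZMod 2))) c =
      TrivSqZeroExt.inl (Polynomial.C c) := rfl
  unfold dualSpecialization
  generalize (n : ZMod 2) + 1 = c
  have hc : Polynomial.C c ^ 2 = Polynomial.C c := by rw [← map_pow, hsq]
  simp only [map_add, map_mul, map_pow, aeval_X, aeval_C, hC]
  ext1
  · simp only [pow_mul', Matrix.cons_val, TrivSqZeroExt.fst_add, TrivSqZeroExt.fst_mul,
      TrivSqZeroExt.fst_pow, TrivSqZeroExt.fst_inl, DualNumber.fst_eps, TrivSqZeroExt.fst_one,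
      TrivSqZeroExt.fst_zero]
    linear_combination (Polynomial.X ^ n) ^ 2 * (hc + Polynomial.C c * h2)
  · suffices Polynomial.C c * Polynomial.X ^ n + Polynomial.C c * Polynomial.X ^ n = 0 by
      simpa [pow_two]
    linear_combination Polynomial.C c * Polynomial.X ^ n * h2

lemma x_pow_mul_v_mul_w_ne_zero (n : ℕ) : x n ^ (2 * n + 1) * v n * w n ≠ 0 := by
  intro h
  have hmem : (X 0 : P) ^ (2 * n + 1) * X 1 * X 2 ∈ relIdeal n := by
    apply Ideal.Quotient.eq_zero_iff_mem.1
    simpa [x, v, w, mkR] using h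
  obtain ⟨p, q, hpq⟩ := Ideal.mem_span_pair.1 hmem
  have h' := congrArg (fun r => (dualSpecialization n r).snd) hpq
  rw [map_add, map_mul, map_mul _ q, dualSpecialization_quadratic] at h'
  have hdvd : (Polynomial.X : Polynomial (ZMod 2)) ^ (2 * n + 2) ∣ Polynomial.X ^ (2 * n + 1) :=
    Dvd.intro_left _ (by simpa [dualSpecialization] using h')
  exact absurd ((pow_dvd_pow_iff Polynomial.X_ne_zero Polynomial.not_isUnit_X).1 hdvd) (by omega)

/-- In a char-2 B-V datum, `Δ` is linear over even powers of any `a` with `Δ a = 0`. -/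
lemma map_pow_two_mul_of_leibniz {A : Type*} [CommRing A] (h2 : (2 : A) = 0) (Δ : A → A)
    (br : A → A → A) (hbr : ∀ a b : A, br a b = Δ (a * b) + Δ a * b + a * Δ b)
    (halt : ∀ a : A, br a a = 0)
    (hleib : ∀ a b c : A, br a (b * c) = br a b * c + b * br a c)
    {a : A} (ha : Δ a = 0) (k : ℕ) (b : A) : Δ (a ^ (2 * k) * b) = a ^ (2 * k) * Δ b := by
  have hsq : Δ (a * a) = 0 := by
    have := hbr a a
    rw [halt, ha] at this
    linear_combination -this
  induction k generalizing b with
  | zero => simp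
  | succ k ih =>
    have hb (b : A) : Δ (a * a * b) = a * a * Δ b := by
      have h := hleib b a a
      rw [hbr b (a * a), hsq, mul_comm b (a * a)] at h
      linear_combination h + (a * br b a - a * a * Δ b) * h2
    rw [show a ^ (2 * (k + 1)) * b = a ^ (2 * k) * (a * a * b) by ring, ih, hb]
    ring

/-- If `n ≥ 2` and `(R, Δ)` is a char-2 B-V datum with `Δ x = 0`, `Δ w = 0`,
`⁅x,v⁆ = v` or `v + x^{2n} v w`, and `Δ v = 0` or `Δ v = x^{2n-1} v w`, then `Δ v = 0`. -/
theorem stmt_13 (n : ℕ) (hn : 2 ≤ n)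
    (Δ : R n → R n) (hΔadd : ∀ a b : R n, Δ (a + b) = Δ a + Δ b)
    (hΔΔ : ∀ a : R n, Δ (Δ a) = 0)
    (br : R n → R n → R n)
    (hbr : ∀ a b : R n, br a b = Δ (a * b) + Δ a * b + a * Δ b)
    (halt : ∀ a : R n, br a a = 0)
    (hleib : ∀ a b c : R n, br a (b * c) = br a b * c + b * br a c)
    (hΔx : Δ (x n) = 0) (hΔw : Δ (w n) = 0)
    (hxv : br (x n) (v n) = v n ∨
      br (x n) (v n) = v n + x n ^ (2 * n) * v n * w n)
    (hΔv : Δ (v n) = 0 ∨ Δ (v n) = x n ^ (2 * n - 1) * v n * w n) :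
    Δ (v n) = 0 := by
  refine hΔv.resolve_right fun hv => x_pow_mul_v_mul_w_ne_zero n ?_
  have h2 := R_two_eq_zero n
  have hx := x_pow_eq_zero n
  have heven := map_pow_two_mul_of_leibniz h2 Δ br hbr halt hleib hΔx n (v n * w n)
  obtain ⟨m, rfl⟩ : ∃ m, n = m + 1 := ⟨n - 1, by omega⟩
  simp only [show 2 * (m + 1) - 1 = 2 * m + 1 by omega] at hv
  have hxΔv : x (m + 1) * Δ (v (m + 1)) = x (m + 1) ^ (2 * (m + 1)) * (v (m + 1) * w (m + 1)) := by
    rw [hv]; ring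
  have hb := hbr (x (m + 1)) (v (m + 1))
  rw [hΔx, hxΔv] at hb
  have hΔb := congrArg Δ hb
  simp only [zero_mul, add_zero, hΔadd, hΔΔ, zero_add, heven] at hΔb
  rcases hxv with h | h
  · rw [h, hv] at hΔb
    linear_combination x (m + 1) ^ 2 * hΔb + Δ (v (m + 1) * w (m + 1)) * hx
  · rw [h, hΔadd, mul_assoc (x (m + 1) ^ _), heven, hv] at hΔb
    linear_combination x (m + 1) ^ 2 * hΔb

end
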